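/- For n ≥ 0 define the polynomial Q_n(x) = Σ_{π ∈ S_n(1-3-2)} x^{s'(π)} (with Q_0 = 1), where s'(π) is the total number of almost 2-increasing subsequences of π. Then for all n ≥ 0, Q_{n+1}(x) = Q_n(x²) + x · Σ_{a+b=n, b≥1} Q_a(x²)·Q_b(x), where Q_a(x²) denotes the polynomial Q_a with x replaced by x². -/

import Mathlib

/-- An occurrence of the classical pattern 1-3-2 in a sequence `w` of distinct
integers is a triple of indices `i < j < k` with `w i < w k < w j`;
`w` avoids 1-3-2 if it has no such occurrence. -/
def Avoids132 {m : ℕ} (w : Fin m → ℤ) : Prop :=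
  ∀ i j k : Fin m, i < j → j < k → ¬(w i < w k ∧ w k < w j)

/-- `π : Fin n → ℤ` is a permutation of length `n`, i.e. a sequence containing
each of the integers `1,…,n` exactly once. -/
def IsPermSeq (n : ℕ) (π : Fin n → ℤ) : Prop :=
  Function.Injective π ∧ ∀ i, 1 ≤ π i ∧ π i ≤ (n : ℤ)

/-- The prefix `π' = (π_1, …, π_{j-1})` of `π` strictly before position `j`. -/
def leftPart {n : ℕ} (π : Fin n → ℤ) (j : Fin n) : Fin (j : ℕ) → ℤ :=
  fun a => π ⟨(a : ℕ), lt_trans a.isLt j.isLt⟩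

/-- The suffix `π'' = (π_{j+1}, …, π_n)` of `π` strictly after position `j`. -/
def rightPart {n : ℕ} (π : Fin n → ℤ) (j : Fin n) : Fin (n - (j : ℕ) - 1) → ℤ :=
  fun a => π ⟨(j : ℕ) + 1 + (a : ℕ), by have h1 := a.isLt; have h2 := j.isLt; omega⟩

/-- An occurrence of the generalized pattern `12-3-…-k` in `w`:
indices `i 0 < i 1 < ⋯ < i (k-1)` with `i 1 = i 0 + 1` and
`w (i 0) < w (i 1) < ⋯ < w (i (k-1))`. -/
def Occ12 {m : ℕ} (k : ℕ) (w : Fin m → ℤ) (i : Fin k → Fin m) : Prop :=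
  StrictMono i ∧ StrictMono (w ∘ i) ∧
    ∀ a b : Fin k, (a : ℕ) = 0 → (b : ℕ) = 1 → (i b : ℕ) = (i a : ℕ) + 1

/-- The relative order of the letters of the pattern `21-3-…-k`. -/
def fPat (j : ℕ) : ℕ := if j = 0 then 1 else if j = 1 then 0 else j

/-- An occurrence of the generalized pattern `21-3-…-k` in `w`:
indices `i 0 < i 1 < ⋯ < i (k-1)` with `i 1 = i 0 + 1` and
`w (i 1) < w (i 0) < w (i 2) < ⋯ < w (i (k-1))`. -/
def Occ21 {m : ℕ} (k : ℕ) (w : Fin m → ℤ) (i : Fin k → Fin m) : Prop :=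
  StrictMono i ∧ (∀ a b : Fin k, fPat (a : ℕ) < fPat (b : ℕ) ↔ w (i a) < w (i b)) ∧
    ∀ a b : Fin k, (a : ℕ) = 0 → (b : ℕ) = 1 → (i b : ℕ) = (i a : ℕ) + 1

/-- `eStat k w` is the number of occurrences of the generalized pattern
`12-3-…-k` in `w` (for `k = 2` this is the number of ascents). -/
noncomputable def eStat (k : ℕ) {m : ℕ} (w : Fin m → ℤ) : ℕ :=
  Nat.card {i : Fin k → Fin m // Occ12 k w i}

/-- `fStat k w` is the number of occurrences of the generalized pattern
`21-3-…-k` in `w` (for `k = 2` this is the number of descents). -/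
noncomputable def fStat (k : ℕ) {m : ℕ} (w : Fin m → ℤ) : ℕ :=
  Nat.card {i : Fin k → Fin m // Occ21 k w i}

/-- The number of ascents of `w`: indices `i` with `w i < w (i+1)`. -/
noncomputable def asc {m : ℕ} (w : Fin m → ℤ) : ℕ :=
  Nat.card {p : Fin m × Fin m // (p.2 : ℕ) = (p.1 : ℕ) + 1 ∧ w p.1 < w p.2}

/-- The number of descents of `w`: indices `i` with `w i > w (i+1)`. -/
noncomputable def des {m : ℕ} (w : Fin m → ℤ) : ℕ :=
  Nat.card {p : Fin m × Fin m // (p.2 : ℕ) = (p.1 : ℕ) + 1 ∧ w p.2 < w p.1}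

/-- `totE w = Σ_{k ≥ 2} e_k(w)`: the total number of 2-increasing
subsequences of `w`. -/
noncomputable def totE {m : ℕ} (w : Fin m → ℤ) : ℕ :=
  Nat.card ((k : ℕ) × {i : Fin k → Fin m // 2 ≤ k ∧ Occ12 k w i})

/-- `totF w = Σ_{k ≥ 2} f_k(w)`: the total number of almost 2-increasing
subsequences of `w`. -/
noncomputable def totF {m : ℕ} (w : Fin m → ℤ) : ℕ :=
  Nat.card ((k : ℕ) × {i : Fin k → Fin m // 2 ≤ k ∧ Occ21 k w i})

/-- The extension by `0` of a sequence of length `n` to all of `ℕ`. -/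
def zeroExt {n : ℕ} (π : Fin n → ℤ) (i : ℕ) : ℤ := if h : i < n then π ⟨i, h⟩ else 0

lemma zeroExt_val {n : ℕ} (π : Fin n → ℤ) (i : Fin n) : zeroExt π i = π i := by
  simp [zeroExt]

lemma zeroExt_injective (n : ℕ) : Function.Injective (zeroExt (n := n)) := by
  intro π ρ h
  funext i
  rw [← zeroExt_val π, ← zeroExt_val ρ, h]

/-- `w` is the extension by `0` of a 1-3-2 avoiding permutation of length `n`. -/
structure IsPerm132 (n : ℕ) (w : ℕ → ℤ) : Prop where
  one_le : ∀ i < n, 1 ≤ w i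
  le : ∀ i < n, w i ≤ n
  zero : ∀ i, n ≤ i → w i = 0
  inj : ∀ i < n, ∀ j < n, w i = w j → i = j
  avoids : ∀ i j k, i < j → j < k → k < n → ¬(w i < w k ∧ w k < w j)

lemma isPerm132_zeroExt {n : ℕ} {π : Fin n → ℤ} (h : IsPermSeq n π) (h' : Avoids132 π) :
    IsPerm132 n (zeroExt π) where
  one_le i hi := by simpa [zeroExt, hi] using (h.2 ⟨i, hi⟩).1
  le i hi := by simpa [zeroExt, hi] using (h.2 ⟨i, hi⟩).2
  zero i hi := by simp [zeroExt, hi]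
  inj i hi j hj hij := by
    simp only [zeroExt, hi, hj, dite_true] at hij
    simpa using h.1 hij
  avoids i j k hij hjk hk := by
    have := h' ⟨i, by omega⟩ ⟨j, by omega⟩ ⟨k, hk⟩ hij hjk
    simpa [zeroExt, hk, hjk.trans hk, hij.trans (hjk.trans hk)] using this

lemma IsPerm132.exists_zeroExt {n : ℕ} {w : ℕ → ℤ} (h : IsPerm132 n w) :
    ∃ π : Fin n → ℤ, (IsPermSeq n π ∧ Avoids132 π) ∧ zeroExt π = w := by
  refine ⟨fun i => w i, ⟨⟨fun i j hij => Fin.ext (h.inj i i.2 j j.2 hij),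
    fun i => ⟨h.one_le i i.2, h.le i i.2⟩⟩, fun i j k hij hjk => h.avoids i j k hij hjk k.2⟩, ?_⟩
  funext i
  by_cases hi : i < n
  · simp [zeroExt, hi]
  · simp [zeroExt, hi, h.zero i (by omega)]

/-- `I` is the set of positions of an almost 2-increasing subsequence of `w`. -/
def Is21Chain (w : ℕ → ℤ) (I : Finset ℕ) : Prop :=
  ∃ p ∈ I, p + 1 ∈ I ∧ w (p + 1) < w p ∧
    (∀ r ∈ I, r = p ∨ r = p + 1 ∨ (p + 1 < r ∧ w p < w r)) ∧
    ∀ r ∈ I, ∀ s ∈ I, p + 1 < r → r < s → w r < w s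

open Classical in
/-- The position sets of the almost 2-increasing subsequences among the first `m` entries. -/
noncomputable def chains (m : ℕ) (w : ℕ → ℤ) : Finset (Finset ℕ) :=
  {I ∈ (Finset.range m).powerset | Is21Chain w I}

lemma mem_chains {m : ℕ} {w : ℕ → ℤ} {I : Finset ℕ} :
    I ∈ chains m w ↔ (∀ r ∈ I, r < m) ∧ Is21Chain w I := by
  simp [chains, Finset.subset_iff]

lemma Occ21.is21Chain {m k : ℕ} {π : Fin m → ℤ} {i : Fin k → Fin m} (hk : 2 ≤ k)
    (h : Occ21 k π i) : Is21Chain (zeroExt π) (Finset.univ.image fun a => (i a : ℕ)) := by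
  obtain ⟨hm, ho, ha⟩ := h
  have h01 := ha ⟨0, by omega⟩ ⟨1, by omega⟩ rfl rfl
  refine ⟨i ⟨0, by omega⟩, by simp, ?_, ?_, ?_, ?_⟩
  · rw [← h01]; simp
  · rw [← h01, zeroExt_val, zeroExt_val, ← ho]
    simp [fPat]
  · simp only [Finset.mem_image, Finset.mem_univ, true_and, forall_exists_index,
      forall_apply_eq_imp_iff]
    rintro ⟨a, hlt⟩
    rcases a with _ | _ | a
    · exact Or.inl rfl
    · exact Or.inr (Or.inl h01)
    · refine Or.inr (Or.inr ⟨?_, ?_⟩)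
      · rw [← h01]
        exact hm (by simp [Fin.lt_def])
      · rw [zeroExt_val, zeroExt_val, ← ho]
        simp [fPat]
  · simp only [Finset.mem_image, Finset.mem_univ, true_and, forall_exists_index,
      forall_apply_eq_imp_iff]
    rintro a b h1 h2
    rw [← h01] at h1
    have h3 : (⟨1, by omega⟩ : Fin k) < a := hm.lt_iff_lt.1 (Fin.lt_def.2 h1)
    have h4 : a < b := hm.lt_iff_lt.1 (Fin.lt_def.2 h2)
    rw [zeroExt_val, zeroExt_val, ← ho]
    simp only [Fin.lt_def] at h3 h4
    simp only [fPat]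
    split_ifs <;> omega

lemma Is21Chain.exists_occ21 {m : ℕ} {π : Fin m → ℤ} {I : Finset ℕ} (hI : ∀ r ∈ I, r < m)
    (h : Is21Chain (zeroExt π) I) :
    ∃ (k : ℕ) (i : Fin k → Fin m), 2 ≤ k ∧ Occ21 k π i ∧
      (Finset.univ.image fun a => (i a : ℕ)) = I := by
  obtain ⟨p, hp, hq, hlt, hmin, hinc⟩ := h
  have hk : 2 ≤ I.card := by
    rw [← Finset.card_pair (show p ≠ p + 1 by omega)]
    exact Finset.card_le_card (by simp [Finset.insert_subset_iff, hp, hq])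
  set e := I.orderEmbOfFin rfl with he
  have hmem : ∀ a, e a ∈ I := I.orderEmbOfFin_mem rfl
  have hsurj : ∀ r ∈ I, ∃ a, e a = r := fun r hr => by
    have : r ∈ Set.range e := by rw [he, Finset.range_orderEmbOfFin]; exact hr
    exact this
  have e0 : e ⟨0, by omega⟩ = p := by
    obtain ⟨a, ha⟩ := hsurj p hp
    have h1 : e ⟨0, by omega⟩ ≤ e a := e.monotone (by simp [Fin.le_def])
    have := hmin _ (hmem ⟨0, by omega⟩)
    omega
  have e1 : e ⟨1, by omega⟩ = p + 1 := by
    obtain ⟨a, ha⟩ := hsurj _ hq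
    have h0 : (⟨0, by omega⟩ : Fin I.card) < a := e.lt_iff_lt.1 (by omega)
    have h1 : e ⟨1, by omega⟩ ≤ e a := e.monotone (by simp only [Fin.le_def, Fin.lt_def] at *; omega)
    have h2 : e ⟨0, by omega⟩ < e ⟨1, by omega⟩ := e.strictMono (by simp [Fin.lt_def])
    omega
  have hpos : ∀ a : Fin I.card, 2 ≤ (a : ℕ) → p + 1 < e a := fun a ha => by
    rw [← e1]; exact e.strictMono (by simp only [Fin.lt_def]; omega)
  have hbig : ∀ a : Fin I.card, 2 ≤ (a : ℕ) → zeroExt π p < zeroExt π (e a) := fun a ha => by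
    have := hpos a ha
    rcases hmin _ (hmem a) with h | h | h
    · omega
    · omega
    · exact h.2
  have hlt' : ∀ a b : Fin I.card, fPat a < fPat b → zeroExt π (e a) < zeroExt π (e b) := by
    intro a b hab
    by_cases ha : 2 ≤ (a : ℕ)
    · have hb : (a : ℕ) < b := by
        simp only [fPat] at hab; split_ifs at hab <;> omega
      exact hinc _ (hmem a) _ (hmem b) (hpos a ha) (e.strictMono hb)
    · have hab' : ((a : ℕ) = 1 ∧ (b : ℕ) = 0) ∨ (a : ℕ) = 0 ∧ 2 ≤ (b : ℕ) ∨
          (a : ℕ) = 1 ∧ 2 ≤ (b : ℕ) := by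
        simp only [fPat] at hab; split_ifs at hab <;> omega
      rcases hab' with ⟨h1, h2⟩ | ⟨h1, h2⟩ | ⟨h1, h2⟩
      · rwa [show a = ⟨1, by omega⟩ from Fin.ext h1, show b = ⟨0, by omega⟩ from Fin.ext h2, e0, e1]
      · rw [show a = ⟨0, by omega⟩ from Fin.ext h1, e0]
        exact hbig b h2
      · rw [show a = ⟨1, by omega⟩ from Fin.ext h1, e1]
        exact hlt.trans (hbig b h2)
  refine ⟨I.card, fun a => ⟨e a, hI _ (hmem a)⟩, hk, ⟨fun a b hab => e.strictMono hab, ?_, ?_⟩, ?_⟩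
  · intro a b
    have key : ∀ c : Fin I.card, π ⟨e c, hI _ (hmem c)⟩ = zeroExt π (e c) := fun c =>
      (zeroExt_val π ⟨e c, hI _ (hmem c)⟩).symm
    simp only [key]
    refine ⟨hlt' a b, fun h => ?_⟩
    by_contra hn
    rcases (not_lt.1 hn).lt_or_eq with h' | h'
    · exact (hlt' b a h').asymm h
    · have : (a : ℕ) = b := by
        simp only [fPat] at h'; split_ifs at h' <;> omega
      rw [Fin.ext this] at h
      exact lt_irrefl _ h
  · intro a b ha hb
    simp only
    rw [show a = ⟨0, by omega⟩ from Fin.ext ha, show b = ⟨1, by omega⟩ from Fin.ext hb, e0, e1]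
  · ext r
    simp only [Finset.mem_image, Finset.mem_univ, true_and]
    exact ⟨fun ⟨a, ha⟩ => ha ▸ hmem a, hsurj r⟩

lemma totF_eq_card_chains {m : ℕ} (π : Fin m → ℤ) : totF π = (chains m (zeroExt π)).card := by
  rw [totF, ← Nat.card_eq_finsetCard]
  refine Nat.card_eq_of_bijective (fun x => ⟨Finset.univ.image fun a => (x.2.1 a : ℕ),
    mem_chains.2 ⟨by simp, x.2.2.2.is21Chain x.2.2.1⟩⟩) ⟨?_, ?_⟩
  · rintro ⟨k, i, hk, hi⟩ ⟨l, i', hl, hi'⟩ h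
    simp only [Subtype.mk.injEq] at h
    have hmono : StrictMono fun a => (i a : ℕ) := fun a b hab => hi.1 hab
    have hmono' : StrictMono fun a => (i' a : ℕ) := fun a b hab => hi'.1 hab
    have hkl : k = l := by
      have := congrArg Finset.card h
      rwa [Finset.card_image_of_injective _ hmono.injective,
        Finset.card_image_of_injective _ hmono'.injective, Finset.card_fin, Finset.card_fin] at this
    subst hkl
    have : i = i' := by
      have h2 := (hmono.range_inj hmono').1 (by
        simpa using congrArg (fun s : Finset ℕ => (s : Set ℕ)) h)
      funext a
      exact Fin.ext (congrFun h2 a)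
    subst this
    rfl
  · rintro ⟨I, hI⟩
    obtain ⟨hI, hc⟩ := mem_chains.1 hI
    obtain ⟨k, i, hk, hi, rfl⟩ := hc.exists_occ21 hI
    exact ⟨⟨k, i, hk, hi⟩, rfl⟩

/-- The sequence `σ + b`, followed by `j + b + 1`, followed by `τ`, where `σ` has length `j`. -/
def glue (j b : ℕ) (σ τ : ℕ → ℤ) (i : ℕ) : ℤ :=
  if i < j then σ i + b else if i = j then j + b + 1 else τ (i - (j + 1))

lemma chains_congr {m : ℕ} {w v : ℕ → ℤ} (c : ℤ) (h : ∀ i < m, w i = v i + c) :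
    chains m w = chains m v := by
  ext I
  simp only [mem_chains]
  refine and_congr_right fun hI => exists_congr fun p => and_congr_right fun hp =>
    and_congr_right fun hq => and_congr ?_ (and_congr ?_ ?_)
  · rw [h _ (hI _ hp), h _ (hI _ hq), add_lt_add_iff_right]
  · refine forall₂_congr fun r hr => ?_
    rw [h _ (hI _ hp), h _ (hI _ hr), add_lt_add_iff_right]
  · refine forall₂_congr fun r hr => forall₂_congr fun s hs => ?_
    rw [h _ (hI _ hr), h _ (hI _ hs), add_lt_add_iff_right]

/-- Every chain of a sequence with its maximum at `j` and all entries before `j` larger than all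
entries after `j` lies before `j`, or is such a chain with `j` appended, or is `{j, j + 1}`,
or lies after `j`. -/
lemma chains_eq_union {j b : ℕ} {w : ℕ → ℤ} (h1 : ∀ i < j, w i < w j)
    (h2 : ∀ r, j < r → r < j + b + 1 → w r < w j)
    (h3 : ∀ l < j, ∀ r, j < r → r < j + b + 1 → w r < w l) :
    chains (j + b + 1) w = (chains j w ∪ (chains j w).image (insert j)) ∪
      ((chains b fun i => w (i + (j + 1))).image (Finset.image (· + (j + 1))) ∪
        if b = 0 then ∅ else {{j, j + 1}}) := by
  ext I
  simp only [Finset.mem_union, Finset.mem_image]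
  constructor
  · rw [mem_chains]
    rintro ⟨hI, p, hp, hq, hlt, hmin, hinc⟩
    have hqI := hI _ hq
    rcases lt_trichotomy p j with hpj | rfl | hpj
    · left
      have hqj : p + 1 < j := by
        by_contra hn
        have : p + 1 = j := by omega
        have := h1 p hpj
        grind
      have hle : ∀ r ∈ I, r ≤ j := by
        intro r hr
        by_contra hn
        have := h3 p hpj r (by omega) (hI r hr)
        rcases hmin r hr with h | h | h
        · omega
        · omega
        · linarith [h.2]
      by_cases hj : j ∈ I
      · right
        refine ⟨I.erase j, mem_chains.2 ⟨?_, p, ?_, ?_, hlt, ?_, ?_⟩, Finset.insert_erase hj⟩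
        · intro r hr
          have := hle r (Finset.mem_of_mem_erase hr)
          have := Finset.ne_of_mem_erase hr
          omega
        · exact Finset.mem_erase.2 ⟨by omega, hp⟩
        · exact Finset.mem_erase.2 ⟨by omega, hq⟩
        · exact fun r hr => hmin r (Finset.mem_of_mem_erase hr)
        · exact fun r hr s hs => hinc r (Finset.mem_of_mem_erase hr) s (Finset.mem_of_mem_erase hs)
      · left
        refine mem_chains.2 ⟨fun r hr => ?_, p, hp, hq, hlt, hmin, hinc⟩
        have := hle r hr
        have : r ≠ j := fun h => hj (h ▸ hr)
        omega
    · right; right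
      rw [if_neg (by omega), Finset.mem_singleton]
      ext r
      simp only [Finset.mem_insert, Finset.mem_singleton]
      constructor
      · intro hr
        rcases hmin r hr with h | h | h
        · exact Or.inl h
        · exact Or.inr h
        · have := h2 r (by omega) (hI r hr)
          linarith [h.2]
      · rintro (rfl | rfl) <;> assumption
    · right; left
      have hgt : ∀ r ∈ I, j + 1 ≤ r := fun r hr => by have := hmin r hr; omega
      have himg : (I.image (· - (j + 1))).image (· + (j + 1)) = I := by
        rw [Finset.image_image]
        conv_rhs => rw [← Finset.image_id (s := I)]
        refine Finset.image_congr fun r hr => ?_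
        have := hgt r hr
        simp only [Function.comp, id]
        omega
      have hmem : ∀ r, r ∈ I.image (· - (j + 1)) → r + (j + 1) ∈ I := fun r hr => by
        rw [← himg]; exact Finset.mem_image_of_mem _ hr
      have hmem' : ∀ r, r + (j + 1) ∈ I → r ∈ I.image (· - (j + 1)) := fun r hr =>
        Finset.mem_image.2 ⟨_, hr, by simp⟩
      obtain ⟨p, rfl⟩ : ∃ p', p = p' + (j + 1) := ⟨p - (j + 1), by omega⟩
      rw [show p + (j + 1) + 1 = p + 1 + (j + 1) by ring] at *
      refine ⟨_, mem_chains.2 ⟨fun r hr => ?_, p, hmem' _ hp, hmem' _ hq, hlt,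
        fun r hr => ?_, fun r hr s hs h h' => ?_⟩, himg⟩
      · have := hI _ (hmem r hr); omega
      · have := hmin _ (hmem r hr)
        simpa using this
      · exact hinc _ (hmem r hr) _ (hmem s hs) (by omega) (by omega)
  · rintro ((h | ⟨J, h, rfl⟩) | (⟨J, h, rfl⟩ | h))
    · obtain ⟨hI, hc⟩ := mem_chains.1 h
      exact mem_chains.2 ⟨fun r hr => by have := hI r hr; omega, hc⟩
    · obtain ⟨hI, p, hp, hq, hlt, hmin, hinc⟩ := mem_chains.1 h
      refine mem_chains.2 ⟨?_, p, by simp [hp], by simp [hq], hlt, ?_, ?_⟩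
      · simp only [Finset.mem_insert, forall_eq_or_imp]
        exact ⟨by omega, fun r hr => by have := hI r hr; omega⟩
      · simp only [Finset.mem_insert, forall_eq_or_imp]
        exact ⟨Or.inr (Or.inr ⟨hI _ hq, h1 p (hI _ hp)⟩), hmin⟩
      · simp only [Finset.mem_insert]
        rintro r (rfl | hr) s (rfl | hs) hpr hrs
        · omega
        · have := hI s hs; omega
        · exact h1 r (hI r hr)
        · exact hinc r hr s hs hpr hrs
    · obtain ⟨hI, p, hp, hq, hlt, hmin, hinc⟩ := mem_chains.1 h
      refine mem_chains.2 ⟨?_, p + (j + 1), by simp [hp], ?_, ?_, ?_, ?_⟩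
      · simp only [Finset.forall_mem_image]
        exact fun r hr => by have := hI r hr; omega
      · exact Finset.mem_image.2 ⟨p + 1, hq, by ring⟩
      · rwa [show p + (j + 1) + 1 = p + 1 + (j + 1) by ring]
      · simp only [Finset.forall_mem_image]
        intro r hr
        have := hmin r hr
        rcases this with h | h | h
        · omega
        · omega
        · exact Or.inr (Or.inr ⟨by omega, h.2⟩)
      · simp only [Finset.forall_mem_image]
        exact fun r hr s hs h h' => hinc r hr s hs (by omega) (by omega)
    · split_ifs at h with hb
      · simp at h
      · rw [Finset.mem_singleton] at h
        subst h
        refine mem_chains.2 ⟨by simp; omega, j, by simp, by simp, h2 _ (by omega) (by omega),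
          ?_, ?_⟩
        · simp
        · simp only [Finset.mem_insert, Finset.mem_singleton]
          intros; omega

lemma Is21Chain.nonempty {w : ℕ → ℤ} {I : Finset ℕ} (h : Is21Chain w I) : I.Nonempty :=
  ⟨_, h.choose_spec.1⟩

lemma card_chains_eq {j b : ℕ} {w : ℕ → ℤ} (h1 : ∀ i < j, w i < w j)
    (h2 : ∀ r, j < r → r < j + b + 1 → w r < w j)
    (h3 : ∀ l < j, ∀ r, j < r → r < j + b + 1 → w r < w l) :
    (chains (j + b + 1) w).card = 2 * (chains j w).card +
      (chains b fun i => w (i + (j + 1))).card + if b = 0 then 0 else 1 := by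
  have hj : ∀ I ∈ chains j w, j ∉ I := fun I hI h => by
    have := (mem_chains.1 hI).1 j h; omega
  have hmeet : ∀ I ∈ chains j w, ∃ r ∈ I, r < j := fun I hI => by
    obtain ⟨r, hr⟩ := (mem_chains.1 hI).2.nonempty
    exact ⟨r, hr, (mem_chains.1 hI).1 r hr⟩
  rw [chains_eq_union h1 h2 h3, Finset.card_union_of_disjoint, Finset.card_union_of_disjoint,
    Finset.card_union_of_disjoint, Finset.card_image_of_injOn, Finset.card_image_of_injective]
  · split_ifs <;> simp <;> ring
  · exact Finset.image_injective (add_left_injective _)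
  · intro I hI J hJ h
    rw [← Finset.erase_insert (hj I hI), ← Finset.erase_insert (hj J hJ)]
    exact congrArg (fun s : Finset ℕ => s.erase j) h
  · split_ifs with hb
    · simp
    · rw [Finset.disjoint_singleton_right, Finset.mem_image]
      rintro ⟨I, -, h⟩
      have : j ∈ I.image (· + (j + 1)) := by rw [h]; simp
      obtain ⟨r, -, hr⟩ := Finset.mem_image.1 this
      omega
  · rw [Finset.disjoint_left]
    rintro I hI h
    obtain ⟨J, -, rfl⟩ := Finset.mem_image.1 h
    exact hj _ hI (Finset.mem_insert_self _ _)
  · have hlow : ∀ I ∈ chains j w ∪ (chains j w).image (insert j), ∃ r ∈ I, r < j := by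
      intro I hI
      rcases Finset.mem_union.1 hI with h | h
      · exact hmeet I h
      · obtain ⟨J, hJ, rfl⟩ := Finset.mem_image.1 h
        obtain ⟨r, hr, hrj⟩ := hmeet J hJ
        exact ⟨r, Finset.mem_insert_of_mem hr, hrj⟩
    rw [Finset.disjoint_left]
    intro I hI h
    obtain ⟨r, hr, hrj⟩ := hlow I hI
    rcases Finset.mem_union.1 h with h | h
    · obtain ⟨J, -, rfl⟩ := Finset.mem_image.1 h
      obtain ⟨s, -, rfl⟩ := Finset.mem_image.1 hr
      omega
    · split_ifs at h
      · simp at h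
      · rw [Finset.mem_singleton] at h
        subst h
        simp at hr
        omega

lemma glue_of_lt {j b i : ℕ} (σ τ : ℕ → ℤ) (h : i < j) : glue j b σ τ i = σ i + b := if_pos h

lemma glue_self (j b : ℕ) (σ τ : ℕ → ℤ) : glue j b σ τ j = j + b + 1 := by simp [glue]

lemma glue_add (j b i : ℕ) (σ τ : ℕ → ℤ) : glue j b σ τ (i + (j + 1)) = τ i := by
  simp only [glue]
  rw [if_neg (by omega), if_neg (by omega), Nat.add_sub_cancel]

lemma lt_or_eq_or_exists_add (j i : ℕ) : i < j ∨ i = j ∨ ∃ i', i = i' + (j + 1) := by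
  rcases lt_trichotomy i j with h | h | h
  · exact Or.inl h
  · exact Or.inr (Or.inl h)
  · exact Or.inr (Or.inr ⟨i - (j + 1), by omega⟩)

lemma card_chains_glue {j b : ℕ} {σ τ : ℕ → ℤ} (hσ : IsPerm132 j σ) (hτ : IsPerm132 b τ) :
    (chains (j + b + 1) (glue j b σ τ)).card = 2 * (chains j σ).card +
      (chains b τ).card + if b = 0 then 0 else 1 := by
  rw [card_chains_eq]
  · rw [chains_congr b fun i hi => glue_of_lt σ τ hi]
    simp only [glue_add]
  · intro i hi
    rw [glue_of_lt _ _ hi, glue_self]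
    linarith [hσ.le i hi]
  · intro r hr hr'
    obtain ⟨r, rfl⟩ : ∃ s, r = s + (j + 1) := ⟨r - (j + 1), by omega⟩
    rw [glue_add, glue_self]
    have := hτ.le r (by omega)
    omega
  · intro l hl r hr hr'
    obtain ⟨r, rfl⟩ : ∃ s, r = s + (j + 1) := ⟨r - (j + 1), by omega⟩
    rw [glue_add, glue_of_lt _ _ hl]
    have := hτ.le r (by omega)
    have := hσ.one_le l hl
    omega

lemma isPerm132_glue {j b : ℕ} {σ τ : ℕ → ℤ} (hσ : IsPerm132 j σ) (hτ : IsPerm132 b τ) :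
    IsPerm132 (j + b + 1) (glue j b σ τ) where
  one_le i hi := by
    rcases lt_or_eq_or_exists_add j i with h | rfl | ⟨i, rfl⟩
    · rw [glue_of_lt _ _ h]; linarith [hσ.one_le i h]
    · rw [glue_self]; omega
    · rw [glue_add]; exact hτ.one_le i (by omega)
  le i hi := by
    rcases lt_or_eq_or_exists_add j i with h | rfl | ⟨i, rfl⟩
    · rw [glue_of_lt _ _ h]; push_cast; linarith [hσ.le i h]
    · rw [glue_self]; push_cast; omega
    · rw [glue_add]; push_cast; linarith [hτ.le i (by omega)]
  zero i hi := by
    obtain ⟨i, rfl⟩ : ∃ s, i = s + (j + 1) := ⟨i - (j + 1), by omega⟩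
    rw [glue_add]
    exact hτ.zero i (by omega)
  inj i hi k hk h := by
    rcases lt_or_eq_or_exists_add j i with h1 | h1 | ⟨i', h1⟩ <;>
    rcases lt_or_eq_or_exists_add j k with h2 | h2 | ⟨k', h2⟩ <;>
    simp only [glue_of_lt, glue_self, glue_add, h1, h2] at h
    · exact hσ.inj i h1 k h2 (by linarith)
    · have := hσ.le i h1; omega
    · have := hσ.one_le i h1; have := hτ.le k' (by omega); omega
    · have := hσ.le k h2; omega
    · omega
    · have := hτ.le k' (by omega); omega
    · have := hσ.one_le k h2; have := hτ.le i' (by omega); omega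
    · have := hτ.le i' (by omega); omega
    · rw [h1, h2, hτ.inj i' (by omega) k' (by omega) h]
  avoids i k l hik hkl hl := by
    rintro ⟨h, h'⟩
    rcases lt_or_eq_or_exists_add j i with h1 | h1 | ⟨i, rfl⟩ <;>
    rcases lt_or_eq_or_exists_add j l with h2 | h2 | ⟨l, rfl⟩
    · have h3 := hkl.trans h2
      simp only [glue_of_lt, h1, h2, h3] at h h'
      exact hσ.avoids i k l hik hkl h2 ⟨by linarith, by linarith⟩
    · have h3 : k < j := by omega
      simp only [glue_of_lt, glue_self, h2, h3] at h'
      have := hσ.le k h3; omega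
    · simp only [glue_of_lt, glue_add, h1] at h
      have := hσ.one_le i h1; have := hτ.le l (by omega); omega
    · omega
    · omega
    · simp only [glue_self, glue_add, h1] at h
      have := hτ.le l (by omega); omega
    · omega
    · omega
    · obtain ⟨k, rfl⟩ : ∃ s, k = s + (j + 1) := ⟨k - (j + 1), by omega⟩
      simp only [glue_add] at h h'
      exact hτ.avoids i k l (by omega) (by omega) (by omega) ⟨h, h'⟩

lemma glue_inj {n j j' : ℕ} {σ τ σ' τ' : ℕ → ℤ} (hj : j ≤ n) (hj' : j' ≤ n)
    (hσ : IsPerm132 j σ) (hτ : IsPerm132 (n - j) τ)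
    (hσ' : IsPerm132 j' σ') (hτ' : IsPerm132 (n - j') τ')
    (h : glue j (n - j) σ τ = glue j' (n - j') σ' τ') : j = j' ∧ σ = σ' ∧ τ = τ' := by
  have hjj : j = j' := by
    have hg := isPerm132_glue hσ hτ
    refine hg.inj j (by omega) j' (by omega) ?_
    rw [congrFun h j', glue_self, glue_self]
    omega
  subst hjj
  refine ⟨rfl, funext fun i => ?_, funext fun i => ?_⟩
  · by_cases hi : i < j
    · have := congrFun h i
      rw [glue_of_lt _ _ hi, glue_of_lt _ _ hi] at this
      linarith
    · rw [hσ.zero i (by omega), hσ'.zero i (by omega)]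
  · have := congrFun h (i + (j + 1))
    rwa [glue_add, glue_add] at this

lemma IsPerm132.exists_eq_max {n : ℕ} {w : ℕ → ℤ} (h : IsPerm132 (n + 1) w) :
    ∃ j < n + 1, w j = n + 1 := by
  have := Finset.surj_on_of_inj_on_of_card_le (s := Finset.range (n + 1))
    (t := Finset.Icc (1 : ℤ) (n + 1)) (fun i _ => w i)
    (fun i hi => by
      have hi := Finset.mem_range.1 hi
      exact Finset.mem_Icc.2 ⟨h.one_le i hi, by simpa using h.le i hi⟩)
    (fun i k hi hk => h.inj i (Finset.mem_range.1 hi) k (Finset.mem_range.1 hk))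
    (by simp) (n + 1) (by simp)
  obtain ⟨j, hj, h⟩ := this
  exact ⟨j, Finset.mem_range.1 hj, h.symm⟩

lemma IsPerm132.exists_glue {n : ℕ} {w : ℕ → ℤ} (h : IsPerm132 (n + 1) w) :
    ∃ j ≤ n, ∃ σ τ, IsPerm132 j σ ∧ IsPerm132 (n - j) τ ∧ glue j (n - j) σ τ = w := by
  obtain ⟨j, hj, hmax⟩ := h.exists_eq_max
  have hlt : ∀ i < n + 1, i ≠ j → w i < w j := fun i hi hij => by
    have h1 := h.le i hi
    have h2 : w i ≠ w j := fun h' => hij (h.inj i hi j hj h')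
    push_cast at h1
    omega
  have hcross : ∀ l < j, ∀ r, j < r → r < n + 1 → w r < w l := fun l hl r hr hrn => by
    have h1 := h.avoids l j r hl hr hrn
    have h2 := hlt r hrn (by omega)
    have h3 : w l ≠ w r := fun h' => by have := h.inj l (by omega) r hrn h'; omega
    by_contra hn
    exact h1 ⟨by omega, h2⟩
  have hright : ∀ r, j < r → r < n + 1 → w r ≤ n - j := fun r hr hrn => by
    have := Finset.card_le_card_of_injOn (s := Finset.range (j + 1))
      (t := Finset.Ioc (w r) (n + 1)) w
      (fun i hi => by
        have hi : i < j + 1 := by simpa using hi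
        simp only [Finset.coe_Ioc, Set.mem_Ioc]
        refine ⟨?_, by simpa using h.le i (by omega)⟩
        rcases Nat.lt_succ_iff_lt_or_eq.1 hi with hi | rfl
        · exact hcross i hi r hr hrn
        · exact hlt r hrn (by omega))
      (fun i hi k hk hik => by
        simp at hi hk
        exact h.inj i (by omega) k (by omega) hik)
    simp at this
    omega
  have hleft : ∀ l < j, (n - j : ℤ) + 1 ≤ w l := fun l hl => by
    have := Finset.card_le_card_of_injOn (s := Finset.Ioo j (n + 1))
      (t := Finset.Ico 1 (w l)) w
      (fun i hi => by
        simp only [Finset.coe_Ioo, Set.mem_Ioo] at hi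
        simp only [Finset.coe_Ico, Set.mem_Ico]
        exact ⟨h.one_le i hi.2, hcross l hl i hi.1 hi.2⟩)
      (fun i hi k hk hik => by
        simp at hi hk
        exact h.inj i (by omega) k (by omega) hik)
    have := h.one_le l (by omega)
    simp at *
    omega
  refine ⟨j, by omega, fun i => if i < j then w i - (n - j : ℕ) else 0,
    fun i => w (i + (j + 1)), ⟨?_, ?_, ?_, ?_, ?_⟩, ⟨?_, ?_, ?_, ?_, ?_⟩, ?_⟩
  · intro i hi
    simp only [hi, if_true]
    have := hleft i hi; omega
  · intro i hi
    simp only [hi, if_true]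
    have := hlt i (by omega) (by omega); omega
  · intro i hi
    simp [hi]
  · intro i hi k hk hik
    simp only [hi, hk, if_true] at hik
    exact h.inj i (by omega) k (by omega) (by omega)
  · intro i k l hik hkl hl
    have := h.avoids i k l hik hkl (by omega)
    simpa only [hl, hkl.trans hl, hik.trans (hkl.trans hl), if_true, sub_lt_sub_iff_right] using this
  · exact fun i hi => h.one_le _ (by omega)
  · intro i hi
    have := hright (i + (j + 1)) (by omega) (by omega); omega
  · exact fun i hi => h.zero _ (by omega)
  · intro i hi k hk hik
    have := h.inj _ (by omega) _ (by omega) hik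
    omega
  · exact fun i k l hik hkl hl => h.avoids _ _ _ (by omega) (by omega) (by omega)
  · funext i
    rcases lt_or_eq_or_exists_add j i with hi | rfl | ⟨i, rfl⟩
    · rw [glue_of_lt _ _ hi, if_pos hi]; ring
    · rw [glue_self, hmax]; omega
    · rw [glue_add]

lemma finite_permSeq (n : ℕ) : {π : Fin n → ℤ | IsPermSeq n π ∧ Avoids132 π}.Finite :=
  (Fintype.piFinset fun _ : Fin n => Finset.Icc (1 : ℤ) n).finite_toSet.subset fun π hπ => by
    exact Fintype.mem_piFinset.2 fun i => Finset.mem_Icc.2 (hπ.1.2 i)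

open Classical in
/-- The zero-extended 1-3-2 avoiding permutations of length `n`. -/
noncomputable def perms132 (n : ℕ) : Finset (ℕ → ℤ) := (finite_permSeq n).toFinset.image zeroExt

lemma mem_perms132 {n : ℕ} {w : ℕ → ℤ} : w ∈ perms132 n ↔ IsPerm132 n w := by
  simp only [perms132, Finset.mem_image, Set.Finite.mem_toFinset, Set.mem_ofPred_eq]
  exact ⟨fun ⟨π, hπ, h⟩ => h ▸ isPerm132_zeroExt hπ.1 hπ.2, fun h => h.exists_zeroExt⟩

lemma card_totF_eq (n k : ℕ) :
    Nat.card {π : Fin n → ℤ // IsPermSeq n π ∧ Avoids132 π ∧ totF π = k} =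
      {w ∈ perms132 n | (chains n w).card = k}.card := by
  classical
  rw [← Nat.card_eq_finsetCard]
  refine Nat.card_eq_of_bijective (fun π => ⟨zeroExt π.1, Finset.mem_filter.2
    ⟨mem_perms132.2 (isPerm132_zeroExt π.2.1 π.2.2.1),
      (totF_eq_card_chains π.1).symm.trans π.2.2.2⟩⟩) ⟨?_, ?_⟩
  · intro π ρ h
    exact Subtype.ext (zeroExt_injective n (Subtype.mk.inj h))
  · rintro ⟨w, hw⟩
    obtain ⟨hw, hk⟩ := Finset.mem_filter.1 hw
    obtain ⟨π, hπ, rfl⟩ := (mem_perms132.1 hw).exists_zeroExt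
    exact ⟨⟨π, hπ.1, hπ.2, (totF_eq_card_chains π).trans hk⟩, rfl⟩

/-- The generating polynomial of the 1-3-2 avoiding permutations of length `n`. -/
noncomputable def chainPoly (n : ℕ) : Polynomial ℤ :=
  ∑ w ∈ perms132 n, Polynomial.X ^ (chains n w).card

lemma coeff_chainPoly (n k : ℕ) : (chainPoly n).coeff k =
    (Nat.card {π : Fin n → ℤ // IsPermSeq n π ∧ Avoids132 π ∧ totF π = k} : ℤ) := by
  rw [card_totF_eq, chainPoly, Polynomial.finsetSum_coeff, Finset.card_filter]
  push_cast
  refine Finset.sum_congr rfl fun w _ => ?_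
  rw [Polynomial.coeff_X_pow]
  simp only [eq_comm]

lemma chainPoly_zero : chainPoly 0 = 1 := by
  have h : perms132 0 = {0} := by
    ext w
    rw [mem_perms132, Finset.mem_singleton]
    refine ⟨fun h => funext fun i => h.zero i (Nat.zero_le i), ?_⟩
    rintro rfl
    constructor <;> simp
  have h' : chains 0 0 = ∅ := by
    rw [Finset.eq_empty_iff_forall_notMem]
    intro I hI
    obtain ⟨r, hr⟩ := (mem_chains.1 hI).2.nonempty
    exact absurd ((mem_chains.1 hI).1 r hr) (Nat.not_lt_zero r)
  simp [chainPoly, h, h']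

lemma chainPoly_succ (n : ℕ) : chainPoly (n + 1) =
    ∑ j ∈ Finset.range (n + 1), (chainPoly j).comp (Polynomial.X ^ 2) * chainPoly (n - j) *
      Polynomial.X ^ (if n - j = 0 then 0 else 1) := by
  have h : ∀ j, (chainPoly j).comp (Polynomial.X ^ 2) * chainPoly (n - j) *
      Polynomial.X ^ (if n - j = 0 then 0 else 1) =
      ∑ x ∈ perms132 j ×ˢ perms132 (n - j), Polynomial.X ^ (2 * (chains j x.1).card +
        (chains (n - j) x.2).card + if n - j = 0 then 0 else 1) := by
    intro j
    simp only [chainPoly, Polynomial.sum_comp, Polynomial.X_pow_comp]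
    rw [Finset.sum_mul_sum, ← Finset.sum_product', Finset.sum_mul]
    refine Finset.sum_congr rfl fun x _ => ?_
    rw [← pow_mul, ← pow_add, ← pow_add]
  simp only [h]
  rw [Finset.sum_sigma', chainPoly]
  symm
  refine Finset.sum_nbij (fun x => glue x.1 (n - x.1) x.2.1 x.2.2) ?_ ?_ ?_ ?_
  · rintro ⟨j, σ, τ⟩ hx
    simp only [Finset.mem_sigma, Finset.mem_range, Finset.mem_product, mem_perms132] at hx ⊢
    obtain ⟨hj, hσ, hτ⟩ := hx
    have := isPerm132_glue hσ hτ
    rwa [show j + (n - j) + 1 = n + 1 by omega] at this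
  · rintro ⟨j, σ, τ⟩ hx ⟨j', σ', τ'⟩ hx' hxx
    simp only [Finset.mem_coe, Finset.mem_sigma, Finset.mem_range, Finset.mem_product,
      mem_perms132] at hx hx'
    obtain ⟨rfl, rfl, rfl⟩ := glue_inj (by omega) (by omega) hx.2.1 hx.2.2 hx'.2.1 hx'.2.2 hxx
    rfl
  · intro w hw
    obtain ⟨j, hj, σ, τ, hσ, hτ, rfl⟩ := (mem_perms132.1 hw).exists_glue
    refine ⟨⟨j, σ, τ⟩, ?_, rfl⟩
    simp only [Finset.mem_coe, Finset.mem_sigma, Finset.mem_range, Finset.mem_product,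
      mem_perms132]
    exact ⟨by omega, hσ, hτ⟩
  · rintro ⟨j, σ, τ⟩ hx
    simp only [Finset.mem_sigma, Finset.mem_range, Finset.mem_product, mem_perms132] at hx
    obtain ⟨hj, hσ, hτ⟩ := hx
    simp only
    rw [← card_chains_glue hσ hτ, show j + (n - j) + 1 = n + 1 by omega]

/-- The polynomials `Q_n(x) = Σ_{π ∈ S_n(1-3-2)} x^{s'(π)}`,
where `s'(π)` is the total number of almost 2-increasing subsequences of `π`,
satisfy `Q_{n+1}(x) = Q_n(x²) + x · Σ_{a+b=n, b≥1} Q_a(x²)·Q_b(x)`. -/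
theorem totF_polynomial_recurrence (Q : ℕ → Polynomial ℤ)
    (hQ : ∀ n k, (Q n).coeff k =
      (Nat.card {π : Fin n → ℤ // IsPermSeq n π ∧ Avoids132 π ∧ totF π = k} : ℤ)) :
    ∀ n, Q (n + 1) =
      (Q n).comp (Polynomial.X ^ 2) + Polynomial.X *
        ∑ b ∈ Finset.Icc 1 n, (Q (n - b)).comp (Polynomial.X ^ 2) * Q b := by
  intro n
  have hQ' : Q = chainPoly := by
    funext n
    ext k
    rw [hQ, coeff_chainPoly]
  subst hQ'
  rw [chainPoly_succ, Finset.sum_range_succ, Nat.sub_self, chainPoly_zero, if_pos rfl, pow_zero,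
    mul_one, mul_one, add_comm, Finset.mul_sum]
  congr 1
  refine Finset.sum_bij' (fun j _ => n - j) (fun b _ => n - b) ?_ ?_ ?_ ?_ ?_
  · intro j hj
    simp only [Finset.mem_range, Finset.mem_Icc] at *; omega
  · intro b hb
    simp only [Finset.mem_range, Finset.mem_Icc] at *; omega
  · intro j hj
    simp only [Finset.mem_range] at *; omega
  · intro b hb
    simp only [Finset.mem_Icc] at *; omega
  · intro j hj
    have hj := Finset.mem_range.1 hj
    rw [if_neg (by omega), pow_one, show n - (n - j) = j by omega]
    ring
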